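/- arXiv:math/0311011 — 2 statements merged into one kernel-verified Lean document; each statement's English description precedes it below -/
import Mathlib

section
/- Let V be a finite-dimensional real inner product space, let b ≥ 0 with √b ≤ 3π/4, and let T : V → V be a self-adjoint linear operator all of whose eigenvalues lie in the interval [−b, 0]. Then the operator norm of c(T) − s(T) satisfies ‖c(T) − s(T)‖ ≤ φ₊(√b). -/
open scoped Real

/-- `φ₊(x) = (sin x)/x − cos x` for `x > 0`, and `φ₊(0) = 0`. -/
noncomputable def phiPlus (x : ℝ) : ℝ :=
  if x = 0 then 0 else Real.sin x / x - Real.cos x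

/-- The operator power series `c(B) = ∑ Bⁿ/(2n)!`. -/
noncomputable def opC {E : Type*} [NormedAddCommGroup E] [NormedSpace ℝ E]
    (B : E →L[ℝ] E) : E →L[ℝ] E :=
  ∑' n : ℕ, (((2 * n).factorial : ℝ))⁻¹ • B ^ n

/-- The operator power series `s(B) = ∑ Bⁿ/(2n+1)!`. -/
noncomputable def opS {E : Type*} [NormedAddCommGroup E] [NormedSpace ℝ E]
    (B : E →L[ℝ] E) : E →L[ℝ] E :=
  ∑' n : ℕ, (((2 * n + 1).factorial : ℝ))⁻¹ • B ^ n

theorem summable_inv_factorial_smul_pow {E : Type*} [NormedAddCommGroup E] [NormedSpace ℝ E]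
    [CompleteSpace E] (B : E →L[ℝ] E) {k : ℕ → ℕ} (hk : ∀ n, n ≤ k n) :
    Summable fun n : ℕ => (((k n).factorial : ℝ))⁻¹ • B ^ n := by
  refine Summable.of_norm_bounded (Real.summable_pow_div_factorial ‖B‖) fun n => ?_
  have hpow : ‖B ^ n‖ ≤ ‖B‖ ^ n := by
    rcases Nat.eq_zero_or_pos n with rfl | hn
    · rw [pow_zero, pow_zero]
      exact ContinuousLinearMap.norm_id_le
    · exact norm_pow_le' B hn
  rw [norm_smul, norm_inv, Real.norm_natCast, div_eq_inv_mul]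
  have hfac : (n.factorial : ℝ) ≤ (k n).factorial := by
    exact_mod_cast Nat.factorial_le (hk n)
  gcongr

theorem pow_apply_of_apply_eq_smul {E : Type*} [NormedAddCommGroup E] [NormedSpace ℝ E]
    {B : E →L[ℝ] E} {v : E} {μ : ℝ} (h : B v = μ • v) (n : ℕ) : (B ^ n) v = μ ^ n • v := by
  induction n with
  | zero => simp
  | succ n ih => rw [pow_succ, mul_apply_eq_comp, h, map_smul, ih, smul_smul, pow_succ']

theorem hasSum_smul_of_apply_eq_smul {E : Type*} [NormedAddCommGroup E] [NormedSpace ℝ E]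
    [CompleteSpace E] {B : E →L[ℝ] E} {v : E} {μ : ℝ} (h : B v = μ • v) {k : ℕ → ℕ}
    (hk : ∀ n, n ≤ k n) :
    HasSum (fun n : ℕ => ((((k n).factorial : ℝ))⁻¹ * μ ^ n) • v)
      ((∑' n : ℕ, (((k n).factorial : ℝ))⁻¹ • B ^ n) v) := by
  have hsum := (summable_inv_factorial_smul_pow B hk).hasSum.mapL
    (ContinuousLinearMap.apply ℝ E v)
  simpa [pow_apply_of_apply_eq_smul h, smul_smul] using hsum

theorem opC_apply_of_apply_eq_neg_sq_smul {E : Type*} [NormedAddCommGroup E] [NormedSpace ℝ E]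
    [CompleteSpace E] {B : E →L[ℝ] E} {v : E} {x : ℝ} (h : B v = (-x ^ 2) • v) :
    opC B v = Real.cos x • v := by
  refine (hasSum_smul_of_apply_eq_smul h (k := fun n => 2 * n) fun n => by lia).unique ?_
  convert (Real.hasSum_cos x).smul_const v using 3 with n
  rw [neg_pow, ← pow_mul]
  ring

theorem hasSum_sinc {x : ℝ} (hx : x ≠ 0) :
    HasSum (fun n : ℕ => (((2 * n + 1).factorial : ℝ))⁻¹ * (-x ^ 2) ^ n) (Real.sin x / x) := by
  refine ((Real.hasSum_sin x).div_const x).congr_fun fun n => ?_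
  rw [neg_pow, ← pow_mul, pow_succ]
  field_simp

theorem opC_sub_opS_apply_of_apply_eq_neg_sq_smul {E : Type*} [NormedAddCommGroup E]
    [NormedSpace ℝ E] [CompleteSpace E] {B : E →L[ℝ] E} {v : E} {x : ℝ}
    (h : B v = (-x ^ 2) • v) : (opC B - opS B) v = (-phiPlus x) • v := by
  have hS := hasSum_smul_of_apply_eq_smul h (k := fun n => 2 * n + 1) fun n => by lia
  rw [sub_apply, opC_apply_of_apply_eq_neg_sq_smul h]
  by_cases hx : x = 0
  · subst hx
    have : opS B v = v := by
      refine hS.unique ?_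
      convert hasSum_single 0 fun n hn => ?_ using 1
      · simp
      · simp [hn]
    simp [this, phiPlus]
  · have : opS B v = (Real.sin x / x) • v := hS.unique ((hasSum_sinc hx).smul_const v)
    rw [this, phiPlus, if_neg hx, ← sub_smul, neg_sub]

theorem sin_sub_mul_cos_nonneg {x : ℝ} (h0 : 0 ≤ x) (hx : x ≤ π) :
    0 ≤ Real.sin x - x * Real.cos x := by
  have hd : ∀ y : ℝ, HasDerivAt (fun y => Real.sin y - y * Real.cos y) (y * Real.sin y) y := by
    intro y
    refine ((Real.hasDerivAt_sin y).sub
      ((hasDerivAt_id' y).mul (Real.hasDerivAt_cos y))).congr_deriv ?_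
    ring
  have hmono : MonotoneOn (fun y => Real.sin y - y * Real.cos y) (Set.Icc 0 π) := by
    refine monotoneOn_of_deriv_nonneg (convex_Icc 0 π)
      (fun y _ => (hd y).continuousAt.continuousWithinAt)
      (fun y _ => (hd y).differentiableAt.differentiableWithinAt) fun y hy => ?_
    rw [interior_Icc] at hy
    rw [(hd y).deriv]
    exact mul_nonneg hy.1.le (Real.sin_nonneg_of_nonneg_of_le_pi hy.1.le hy.2.le)
  simpa using hmono ⟨le_rfl, Real.pi_pos.le⟩ ⟨h0, hx⟩ h0

theorem mul_cos_add_sq_sub_one_mul_sin_nonneg {x : ℝ} (h0 : 0 ≤ x) (hx : x ≤ 3 * π / 4) :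
    0 ≤ x * Real.cos x + (x ^ 2 - 1) * Real.sin x := by
  have hpi := Real.pi_gt_d2
  rcases le_total x (π / 2) with hle | hge
  · have hd : ∀ y : ℝ, HasDerivAt (fun y => y * Real.cos y + (y ^ 2 - 1) * Real.sin y)
        (y * (Real.sin y + y * Real.cos y)) y := by
      intro y
      refine (((hasDerivAt_id' y).mul (Real.hasDerivAt_cos y)).add
        (((hasDerivAt_pow 2 y).sub_const 1).mul (Real.hasDerivAt_sin y))).congr_deriv ?_
      push_cast
      ring
    have hmono : MonotoneOn (fun y => y * Real.cos y + (y ^ 2 - 1) * Real.sin y)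
        (Set.Icc 0 (π / 2)) := by
      refine monotoneOn_of_deriv_nonneg (convex_Icc 0 (π / 2))
        (fun y _ => (hd y).continuousAt.continuousWithinAt)
        (fun y _ => (hd y).differentiableAt.differentiableWithinAt) fun y hy => ?_
      rw [interior_Icc] at hy
      rw [(hd y).deriv]
      have hs := Real.sin_nonneg_of_nonneg_of_le_pi hy.1.le (by linarith [hy.2])
      have hc := Real.cos_nonneg_of_neg_pi_div_two_le_of_le (by linarith [hy.1]) hy.2.le
      exact mul_nonneg hy.1.le (add_nonneg hs (mul_nonneg hy.1.le hc))
    simpa using hmono ⟨le_rfl, by positivity⟩ ⟨h0, hle⟩ h0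
  · obtain ⟨t, rfl⟩ : ∃ t, x = t + π / 2 := ⟨x - π / 2, by ring⟩
    rw [Real.cos_add_pi_div_two, Real.sin_add_pi_div_two]
    have ht0 : 0 ≤ t := by linarith
    have ht1 : t ≤ π / 4 := by linarith
    rcases le_total (t + π / 2) 1.62 with hlt | hgt
    · have hsin := Real.sin_le ht0
      have hcos := Real.one_sub_sq_div_two_le_cos (x := t)
      have ht : t ≤ 0.05 := by linarith
      have hc : 0.99 ≤ Real.cos t := by nlinarith
      have h1 : (t + π / 2) * Real.sin t ≤ 1.62 * 0.05 :=
        mul_le_mul hlt (hsin.trans ht) (Real.sin_nonneg_of_nonneg_of_le_pi ht0 (by linarith))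
          (by norm_num)
      have h2 : 1.4 ≤ (t + π / 2) ^ 2 - 1 := by nlinarith
      nlinarith
    · have hc : 0 ≤ Real.cos t :=
        Real.cos_nonneg_of_neg_pi_div_two_le_of_le (by linarith) (by linarith)
      have hsc : Real.sin t ≤ Real.cos t := by
        rw [← Real.cos_pi_div_two_sub]
        exact Real.cos_le_cos_of_nonneg_of_le_pi ht0 (by linarith) (by linarith)
      have h1 := mul_le_mul_of_nonneg_left hsc h0
      have h2 : 0 ≤ (t + π / 2) ^ 2 - 1 - (t + π / 2) := by nlinarith
      nlinarith [mul_nonneg h2 hc]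

theorem phiPlus_nonneg {x : ℝ} (h0 : 0 ≤ x) (hx : x ≤ π) : 0 ≤ phiPlus x := by
  unfold phiPlus
  split_ifs with h
  · exact le_rfl
  · have hpos : 0 < x := lt_of_le_of_ne h0 (Ne.symm h)
    rw [sub_nonneg, le_div_iff₀ hpos]
    linarith [sin_sub_mul_cos_nonneg h0 hx]

theorem monotoneOn_phiPlus : MonotoneOn phiPlus (Set.Icc 0 (3 * π / 4)) := by
  have hd : ∀ y : ℝ, 0 < y → HasDerivAt (fun y => Real.sin y / y - Real.cos y)
      ((y * Real.cos y + (y ^ 2 - 1) * Real.sin y) / y ^ 2) y := by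
    intro y hy
    refine (((Real.hasDerivAt_sin y).div (hasDerivAt_id' y) hy.ne').sub
      (Real.hasDerivAt_cos y)).congr_deriv ?_
    field_simp
    ring
  have hmono : MonotoneOn (fun y => Real.sin y / y - Real.cos y) (Set.Ioc 0 (3 * π / 4)) := by
    refine monotoneOn_of_deriv_nonneg (convex_Ioc 0 _)
      (fun y hy => (hd y hy.1).continuousAt.continuousWithinAt) (fun y hy => ?_) fun y hy => ?_
    · exact (hd y (interior_subset hy).1).differentiableAt.differentiableWithinAt
    · have hy' := interior_subset hy
      rw [(hd y hy'.1).deriv]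
      exact div_nonneg (mul_cos_add_sq_sub_one_mul_sin_nonneg hy'.1.le hy'.2) (sq_nonneg y)
  intro x hx y hy hxy
  rcases hx.1.eq_or_lt with rfl | hpos
  · simpa [phiPlus] using phiPlus_nonneg hy.1 (by linarith [hy.2, Real.pi_pos])
  · have hypos := hpos.trans_le hxy
    simpa [phiPlus, hpos.ne', hypos.ne'] using hmono ⟨hpos, hx.2⟩ ⟨hypos, hy.2⟩ hxy

theorem OrthonormalBasis.opNorm_le_of_apply_eq_smul {ι V : Type*} [Fintype ι]
    [NormedAddCommGroup V] [InnerProductSpace ℝ V] (e : OrthonormalBasis ι ℝ V) {A : V →L[ℝ] V}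
    {a : ι → ℝ} {C : ℝ} (hC : 0 ≤ C) (hA : ∀ i, A (e i) = a i • e i) (ha : ∀ i, |a i| ≤ C) :
    ‖A‖ ≤ C := by
  refine A.opNorm_le_bound hC fun v => ?_
  have hrepr : ∀ i, e.repr (A v) i = a i * e.repr v i := by
    classical
    intro i
    conv_lhs => rw [← e.sum_repr v]
    simp [hA, smul_smul, Pi.single_apply, mul_comm]
  rw [← e.repr.norm_map (A v), ← e.repr.norm_map v]
  refine le_of_sq_le_sq ?_ (by positivity)
  rw [mul_pow, EuclideanSpace.norm_sq_eq, EuclideanSpace.norm_sq_eq, Finset.mul_sum]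
  refine Finset.sum_le_sum fun i _ => ?_
  rw [hrepr, norm_mul, mul_pow, Real.norm_eq_abs (a i)]
  have := ha i
  gcongr

/-- Linear-algebraic content of the sharpened Jacobi-field bound (Proposition 2.5(b)):
if `T` is self-adjoint on a finite-dimensional real inner product space, with all
eigenvalues in `[−b, 0]` and `√b ≤ 3π/4`, then `‖c(T) − s(T)‖ ≤ φ₊(√b)`. -/
theorem stmt3 {V : Type*} [NormedAddCommGroup V] [InnerProductSpace ℝ V]
    [FiniteDimensional ℝ V]
    (b : ℝ) (hb : 0 ≤ b) (hb' : Real.sqrt b ≤ 3 * π / 4)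
    (T : V →L[ℝ] V) (hT : IsSelfAdjoint T)
    (heig : ∀ μ : ℝ, Module.End.HasEigenvalue (T : V →ₗ[ℝ] V) μ → μ ∈ Set.Icc (-b) 0) :
    ‖opC T - opS T‖ ≤ phiPlus (Real.sqrt b) := by
  have hsym : (T : V →ₗ[ℝ] V).IsSymmetric := hT.isSymmetric
  refine (hsym.eigenvectorBasis rfl).opNorm_le_of_apply_eq_smul
    (a := fun i => -phiPlus (√(-hsym.eigenvalues rfl i)))
    (phiPlus_nonneg (Real.sqrt_nonneg b) (by linarith [Real.pi_pos])) (fun i => ?_) fun i => ?_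
  all_goals have hμ := heig _ (hsym.hasEigenvalue_eigenvalues rfl i)
  · apply opC_sub_opS_apply_of_apply_eq_neg_sq_smul
    rw [Real.sq_sqrt (by simpa using hμ.2), neg_neg]
    exact hsym.apply_eigenvectorBasis rfl i
  · have hle : √(-hsym.eigenvalues rfl i) ≤ √b := Real.sqrt_le_sqrt (neg_le.mp hμ.1)
    rw [abs_neg, abs_of_nonneg
      (phiPlus_nonneg (Real.sqrt_nonneg _) (by linarith [Real.pi_pos]))]
    exact monotoneOn_phiPlus ⟨Real.sqrt_nonneg _, hle.trans hb'⟩ ⟨Real.sqrt_nonneg b, hb'⟩ hle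
end

section
/- Fix real numbers δ ≤ Δ and r₁ > 0 with 2·r₁·√(max(0,Δ)) < π, and define κ̃ as in the context. Then for each D ∈ [0, r₁], the function ρ ↦ κ̃(ρ, D) is continuous, monotone nondecreasing, and convex on the interval [D, r₁]. -/
open scoped Real

/-- `φ₋(x) = cosh x − (sinh x)/x` for `x > 0`, and `φ₋(0) = 0`. -/
noncomputable def phiMinus (x : ℝ) : ℝ :=
  if x = 0 then 0 else Real.cosh x - Real.sinh x / x

/-- `C₁(λ,r) = 1` if `λ ≥ 0` or `r = 0`, and `sinh(√(−λ)·r)/(√(−λ)·r)` if `λ < 0, r ≠ 0`. -/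
noncomputable def C1 (lam r : ℝ) : ℝ :=
  if 0 ≤ lam ∨ r = 0 then 1
  else Real.sinh (Real.sqrt (-lam) * r) / (Real.sqrt (-lam) * r)

/-- `h(λ,r)`: equal to `√λ·r·cot(√λ·r)` for `λ > 0`, to `√(−λ)·r·coth(√(−λ)·r)` for
`λ < 0`, and to `1` when `λ = 0` or `r = 0`. -/
noncomputable def hFun (lam r : ℝ) : ℝ :=
  if lam = 0 ∨ r = 0 then 1
  else if 0 < lam then
    Real.sqrt lam * r * (Real.cos (Real.sqrt lam * r) / Real.sin (Real.sqrt lam * r))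
  else
    Real.sqrt (-lam) * r * (Real.cosh (Real.sqrt (-lam) * r) / Real.sinh (Real.sqrt (-lam) * r))

/-- `ψ(λ,r) = sign(λ)·(1 − h(λ,r))`. -/
noncomputable def psiFun (lam r : ℝ) : ℝ := Real.sign lam * (1 - hFun lam r)

/-- `ψmax(δ,Δ,r) = max(ψ(Δ,r), ψ(δ,r))`. -/
noncomputable def psiMax (δ Δ r : ℝ) : ℝ := max (psiFun Δ r) (psiFun δ r)

/-- The contraction-constant function `κ̃(ρ,D)` of Definition 4.4 with constant
curvature bounds `δ ≤ Δ`: `κ̃(ρ,D) = φ₋((ρ+D)√K) + C₁(δ,ρ+D)·ψmax(δ,Δ,ρ+D)` where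
`K = max(|δ|,|Δ|)`. -/
noncomputable def kappaT (δ Δ ρ D : ℝ) : ℝ :=
  phiMinus ((ρ + D) * Real.sqrt (max |δ| |Δ|)) + C1 δ (ρ + D) * psiMax δ Δ (ρ + D)

/-- The margin function `s̃(ρ,D) = (1 − κ̃(ρ,D))·ρ` of Definition 4.4. -/
noncomputable def sT (δ Δ ρ D : ℝ) : ℝ := (1 - kappaT δ Δ ρ D) * ρ

open Set

/-- `f` is nonnegative, continuous, monotone nondecreasing and convex on `s`. -/
structure NonnegMonoConvexOn (f : ℝ → ℝ) (s : Set ℝ) : Prop where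
  nonneg : ∀ ⦃x : ℝ⦄, x ∈ s → 0 ≤ f x
  cont : ContinuousOn f s
  mono : MonotoneOn f s
  convex : ConvexOn ℝ s f

namespace NonnegMonoConvexOn

variable {f g : ℝ → ℝ} {s t : Set ℝ}

lemma const (hs : Convex ℝ s) {c : ℝ} (hc : 0 ≤ c) : NonnegMonoConvexOn (fun _ => c) s :=
  ⟨fun _ _ => hc, continuousOn_const, monotoneOn_const, convexOn_const c hs⟩

lemma congr (hf : NonnegMonoConvexOn f s) (h : EqOn f g s) : NonnegMonoConvexOn g s :=
  ⟨fun _ hx => h hx ▸ hf.nonneg hx, hf.cont.congr h.symm, hf.mono.congr h, hf.convex.congr h⟩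

lemma add (hf : NonnegMonoConvexOn f s) (hg : NonnegMonoConvexOn g s) :
    NonnegMonoConvexOn (fun x => f x + g x) s :=
  ⟨fun _ hx => add_nonneg (hf.nonneg hx) (hg.nonneg hx), hf.cont.add hg.cont,
    hf.mono.add hg.mono, hf.convex.add hg.convex⟩

lemma mul (hf : NonnegMonoConvexOn f s) (hg : NonnegMonoConvexOn g s) :
    NonnegMonoConvexOn (fun x => f x * g x) s :=
  ⟨fun _ hx => mul_nonneg (hf.nonneg hx) (hg.nonneg hx), hf.cont.mul hg.cont,
    hf.mono.mul hg.mono hf.nonneg hg.nonneg,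
    hf.convex.mul hg.convex hf.nonneg hg.nonneg (hf.mono.monovaryOn hg.mono)⟩

lemma max (hf : NonnegMonoConvexOn f s) (hg : NonnegMonoConvexOn g s) :
    NonnegMonoConvexOn (fun x => Max.max (f x) (g x)) s :=
  ⟨fun _ hx => le_max_of_le_left (hf.nonneg hx), hf.cont.sup hg.cont,
    fun _ hx _ hy hxy => max_le_max (hf.mono hx hy hxy) (hg.mono hx hy hxy),
    hf.convex.sup hg.convex⟩

lemma comp_affine (hf : NonnegMonoConvexOn f t) (hs : Convex ℝ s) {c d : ℝ} (hc : 0 ≤ c)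
    (hst : MapsTo (fun x => c * x + d) s t) : NonnegMonoConvexOn (fun x => f (c * x + d)) s := by
  refine ⟨fun x hx => hf.nonneg (hst hx), hf.cont.comp (by fun_prop) hst,
    fun x hx y hy hxy => hf.mono (hst hx) (hst hy) (by dsimp only; gcongr), hs, ?_⟩
  intro x hx y hy a b ha hb hab
  have h := hf.convex.2 (hst hx) (hst hy) ha hb hab
  have e : a • (c * x + d) + b • (c * y + d) = c * (a • x + b • y) + d := by
    simp only [smul_eq_mul]
    linear_combination d * hab
  rwa [e] at h

/-- Second-derivative criterion for a function on nonnegative reals attaining its minimum at `0`. -/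
lemma of_hasDerivAt2 {f' f'' : ℝ → ℝ} (hs : Convex ℝ s) (hs0 : (0 : ℝ) ∈ s) (hsub : s ⊆ Ici 0)
    (hf : ContinuousOn f s) (h0 : 0 ≤ f 0) (hmin : ∀ x ∈ s, f 0 ≤ f x)
    (hfg : EqOn f g (interior s))
    (hf' : ∀ x ∈ interior s, HasDerivAt g (f' x) x)
    (hf'' : ∀ x ∈ interior s, HasDerivAt f' (f'' x) x)
    (hpos : ∀ x ∈ interior s, 0 ≤ f'' x) : NonnegMonoConvexOn f s := by
  have hconv : ConvexOn ℝ s f := convexOn_of_hasDerivWithinAt2_nonneg hs hf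
    (fun x hx => (hf' x hx).hasDerivWithinAt.congr hfg (hfg hx))
    (fun x hx => (hf'' x hx).hasDerivWithinAt) hpos
  refine ⟨fun x hx => h0.trans (hmin x hx), hf, ?_, hconv⟩
  intro x hx y hy hxy
  have hx0 : 0 ≤ x := hsub hx
  have h := hconv.le_max_of_mem_Icc hs0 hy ⟨hx0, hxy⟩
  rwa [max_eq_right (hmin y hy)] at h

end NonnegMonoConvexOn

lemma nonneg_of_hasDerivAt_nonneg {f f' : ℝ → ℝ} {x : ℝ} (hx : 0 ≤ x) (h0 : f 0 = 0)
    (hf : ∀ y, HasDerivAt f (f' y) y) (hpos : ∀ y ∈ Ioo 0 x, 0 ≤ f' y) : 0 ≤ f x := by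
  have h : MonotoneOn f (Icc 0 x) := monotoneOn_of_hasDerivWithinAt_nonneg (convex_Icc 0 x)
    (fun y _ => (hf y).continuousAt.continuousWithinAt)
    (fun y _ => (hf y).hasDerivWithinAt) (by simpa only [interior_Icc] using hpos)
  have := h (left_mem_Icc.2 hx) (right_mem_Icc.2 hx) hx
  rwa [h0] at this

lemma sinh_le_self_mul_cosh {x : ℝ} (hx : 0 ≤ x) : Real.sinh x ≤ x * Real.cosh x := by
  refine sub_nonneg.1 (nonneg_of_hasDerivAt_nonneg (f := fun y => y * Real.cosh y - Real.sinh y)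
    (f' := fun y => y * Real.sinh y) hx (by simp) (fun y => ?_) fun y hy => ?_)
  · refine (((hasDerivAt_id' y).mul (Real.hasDerivAt_cosh y)).sub (Real.hasDerivAt_sinh y)).congr_deriv ?_
    ring
  · exact mul_nonneg hy.1.le (Real.sinh_nonneg_iff.2 hy.1.le)

lemma self_mul_cos_le_sin {x : ℝ} (hx : 0 ≤ x) (hxπ : x ≤ π) : x * Real.cos x ≤ Real.sin x := by
  refine sub_nonneg.1 (nonneg_of_hasDerivAt_nonneg (f := fun y => Real.sin y - y * Real.cos y)
    (f' := fun y => y * Real.sin y) hx (by simp) (fun y => ?_) fun y hy => ?_)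
  · refine ((Real.hasDerivAt_sin y).sub ((hasDerivAt_id' y).mul (Real.hasDerivAt_cos y))).congr_deriv ?_
    ring
  · exact mul_nonneg hy.1.le (Real.sin_nonneg_of_nonneg_of_le_pi hy.1.le (hy.2.le.trans hxπ))

/-- The continuous extension of `sinh x / x`. -/
noncomputable def sinhc : ℝ → ℝ := dslope Real.sinh 0

lemma sinhc_zero : sinhc 0 = 1 := by simp [sinhc]

lemma sinhc_of_ne_zero {x : ℝ} (hx : x ≠ 0) : sinhc x = Real.sinh x / x := by
  simp [sinhc, dslope_of_ne _ hx, slope_def_field]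

lemma continuous_sinhc : Continuous sinhc := by
  rw [← continuousOn_univ, sinhc, continuousOn_dslope Filter.univ_mem]
  exact ⟨Real.continuous_sinh.continuousOn, Real.differentiable_sinh 0⟩

lemma one_le_sinhc {x : ℝ} (hx : 0 ≤ x) : 1 ≤ sinhc x := by
  rcases hx.eq_or_lt with rfl | hx
  · rw [sinhc_zero]
  · rw [sinhc_of_ne_zero hx.ne', one_le_div hx]
    exact Real.self_le_sinh_iff.2 hx.le

lemma sinhc_le_cosh {x : ℝ} (hx : 0 ≤ x) : sinhc x ≤ Real.cosh x := by
  rcases hx.eq_or_lt with rfl | hx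
  · simp [sinhc_zero]
  · rw [sinhc_of_ne_zero hx.ne', div_le_iff₀ hx, mul_comm]
    exact sinh_le_self_mul_cosh hx.le

lemma hasDerivAt_sinh_div {x : ℝ} (hx : x ≠ 0) :
    HasDerivAt (fun y => Real.sinh y / y) (Real.cosh x / x - Real.sinh x / x ^ 2) x := by
  refine ((Real.hasDerivAt_sinh x).div (hasDerivAt_id' x) hx).congr_deriv ?_
  field_simp

lemma hasDerivAt_deriv_sinh_div {x : ℝ} (hx : x ≠ 0) :
    HasDerivAt (fun y => Real.cosh y / y - Real.sinh y / y ^ 2)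
      ((x ^ 2 * Real.sinh x - 2 * x * Real.cosh x + 2 * Real.sinh x) / x ^ 3) x := by
  refine (((Real.hasDerivAt_cosh x).div (hasDerivAt_id' x) hx).sub
    ((Real.hasDerivAt_sinh x).div (hasDerivAt_pow 2 x) (pow_ne_zero 2 hx))).congr_deriv ?_
  field_simp
  push_cast
  ring

lemma nonnegMonoConvexOn_sinhc : NonnegMonoConvexOn sinhc (Ici 0) := by
  refine .of_hasDerivAt2 (g := fun y => Real.sinh y / y)
    (f' := fun y => Real.cosh y / y - Real.sinh y / y ^ 2)
    (f'' := fun x => (x ^ 2 * Real.sinh x - 2 * x * Real.cosh x + 2 * Real.sinh x) / x ^ 3)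
    (convex_Ici 0) self_mem_Ici subset_rfl continuous_sinhc.continuousOn (by simp [sinhc_zero])
    (fun x hx => sinhc_zero ▸ one_le_sinhc hx) ?_ ?_ ?_ ?_ <;> rw [interior_Ici] <;> intro x hx
  · exact sinhc_of_ne_zero hx.ne'
  · exact hasDerivAt_sinh_div hx.ne'
  · exact hasDerivAt_deriv_sinh_div hx.ne'
  · refine div_nonneg (nonneg_of_hasDerivAt_nonneg
      (f := fun y => y ^ 2 * Real.sinh y - 2 * y * Real.cosh y + 2 * Real.sinh y)
      (f' := fun y => y ^ 2 * Real.cosh y) (mem_Ioi.1 hx).le (by simp) (fun y => ?_)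
      fun y _ => by positivity) (pow_nonneg (mem_Ioi.1 hx).le 3)
    refine ((((hasDerivAt_pow 2 y).mul (Real.hasDerivAt_sinh y)).sub
      (((hasDerivAt_id' y).const_mul 2).mul (Real.hasDerivAt_cosh y))).add
      ((Real.hasDerivAt_sinh y).const_mul 2)).congr_deriv ?_
    push_cast
    ring

lemma phiMinus_eq (x : ℝ) : phiMinus x = Real.cosh x - sinhc x := by
  unfold phiMinus
  split_ifs with h
  · simp [h, sinhc_zero]
  · rw [sinhc_of_ne_zero h]

lemma nonnegMonoConvexOn_phiMinus : NonnegMonoConvexOn phiMinus (Ici 0) := by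
  rw [funext phiMinus_eq]
  refine .of_hasDerivAt2 (g := fun y => Real.cosh y - Real.sinh y / y)
    (f' := fun y => Real.sinh y - (Real.cosh y / y - Real.sinh y / y ^ 2))
    (f'' := fun x => Real.cosh x -
      (x ^ 2 * Real.sinh x - 2 * x * Real.cosh x + 2 * Real.sinh x) / x ^ 3)
    (convex_Ici 0) self_mem_Ici subset_rfl
    (Real.continuous_cosh.sub continuous_sinhc).continuousOn (by simp [sinhc_zero])
    (fun x hx => by simpa [sinhc_zero] using sinhc_le_cosh hx) ?_ ?_ ?_ ?_ <;>
    rw [interior_Ici] <;> intro x hx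
  · simp only [sinhc_of_ne_zero hx.ne']
  · exact (Real.hasDerivAt_cosh x).sub (hasDerivAt_sinh_div hx.ne')
  · exact (Real.hasDerivAt_sinh x).sub (hasDerivAt_deriv_sinh_div hx.ne')
  · have hx0 : 0 < x := hx
    rw [sub_nonneg, div_le_iff₀ (by positivity), ← sub_nonneg]
    refine nonneg_of_hasDerivAt_nonneg
      (f := fun y => Real.cosh y * y ^ 3 -
        (y ^ 2 * Real.sinh y - 2 * y * Real.cosh y + 2 * Real.sinh y))
      (f' := fun y => 2 * y ^ 2 * Real.cosh y + y ^ 3 * Real.sinh y) hx0.le (by simp)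
      (fun y => ?_) fun y hy => ?_
    · refine (((Real.hasDerivAt_cosh y).mul (hasDerivAt_pow 3 y)).sub
        ((((hasDerivAt_pow 2 y).mul (Real.hasDerivAt_sinh y)).sub
        (((hasDerivAt_id' y).const_mul 2).mul (Real.hasDerivAt_cosh y))).add
        ((Real.hasDerivAt_sinh y).const_mul 2))).congr_deriv ?_
      push_cast
      ring
    · have := Real.sinh_nonneg_iff.2 hy.1.le
      have := hy.1
      positivity

lemma nonnegMonoConvexOn_cosh_div_sinhc :
    NonnegMonoConvexOn (fun x => Real.cosh x / sinhc x - 1) (Ici 0) := by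
  have hne : ∀ x : ℝ, 0 ≤ x → 0 < sinhc x := fun x hx => one_pos.trans_le (one_le_sinhc hx)
  refine .of_hasDerivAt2 (g := fun y => y * Real.cosh y / Real.sinh y - 1)
    (f' := fun y => Real.cosh y / Real.sinh y - y / Real.sinh y ^ 2)
    (f'' := fun y => 2 * (y * Real.cosh y - Real.sinh y) / Real.sinh y ^ 3)
    (convex_Ici 0) self_mem_Ici subset_rfl
    ((Real.continuous_cosh.continuousOn.div continuous_sinhc.continuousOn
      fun x hx => (hne x hx).ne').sub continuousOn_const) (by simp [sinhc_zero])
    (fun x hx => ?_) ?_ ?_ ?_ ?_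
  · simpa [sinhc_zero] using (one_le_div (hne x hx)).2 (sinhc_le_cosh hx)
  all_goals
    rw [interior_Ici]
    intro x hx
    have hx0 : 0 < x := hx
    have hs : 0 < Real.sinh x := Real.sinh_pos_iff.2 hx0
  · simp only [sinhc_of_ne_zero hx0.ne']
    field_simp
  · refine ((((hasDerivAt_id' x).mul (Real.hasDerivAt_cosh x)).div (Real.hasDerivAt_sinh x)
      hs.ne').sub_const 1).congr_deriv ?_
    simp only [Pi.mul_apply]
    field_simp
    linear_combination (-x) * Real.cosh_sq x
  · refine (((Real.hasDerivAt_cosh x).div (Real.hasDerivAt_sinh x) hs.ne').sub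
      ((hasDerivAt_id' x).div ((Real.hasDerivAt_sinh x).pow 2) (pow_ne_zero 2 hs.ne'))).congr_deriv ?_
    simp only [Pi.pow_apply]
    push_cast
    field_simp
    linear_combination (-Real.sinh x) * Real.cosh_sq x
  · have := sub_nonneg.2 (sinh_le_self_mul_cosh hx0.le)
    positivity

lemma sinc_pos {x : ℝ} (hx : x ∈ Ico 0 π) : 0 < Real.sinc x := by
  rcases hx.1.eq_or_lt with rfl | h
  · simp
  · rw [Real.sinc_of_ne_zero h.ne']
    exact div_pos (Real.sin_pos_of_pos_of_lt_pi h hx.2) h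

lemma cos_le_sinc {x : ℝ} (hx : x ∈ Ico 0 π) : Real.cos x ≤ Real.sinc x := by
  rcases hx.1.eq_or_lt with rfl | h
  · simp
  · rw [Real.sinc_of_ne_zero h.ne', le_div_iff₀ h, mul_comm]
    exact self_mul_cos_le_sin h.le hx.2.le

lemma nonnegMonoConvexOn_cos_div_sinc :
    NonnegMonoConvexOn (fun x => 1 - Real.cos x / Real.sinc x) (Ico 0 π) := by
  refine .of_hasDerivAt2 (g := fun y => 1 - y * Real.cos y / Real.sin y)
    (f' := fun y => y / Real.sin y ^ 2 - Real.cos y / Real.sin y)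
    (f'' := fun y => 2 * (Real.sin y - y * Real.cos y) / Real.sin y ^ 3)
    (convex_Ico 0 π) (left_mem_Ico.2 Real.pi_pos) Ico_subset_Ici_self
    (continuousOn_const.sub (Real.continuous_cos.continuousOn.div
      Real.continuous_sinc.continuousOn fun x hx => (sinc_pos hx).ne')) (by simp)
    (fun x hx => ?_) ?_ ?_ ?_ ?_
  · simpa using (div_le_one (sinc_pos hx)).2 (cos_le_sinc hx)
  all_goals
    rw [interior_Ico]
    intro x hx
    have hx0 : 0 < x := hx.1
    have hs : 0 < Real.sin x := Real.sin_pos_of_pos_of_lt_pi hx0 hx.2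
  · simp only [Real.sinc_of_ne_zero hx0.ne']
    field_simp
  · refine ((((hasDerivAt_id' x).mul (Real.hasDerivAt_cos x)).div (Real.hasDerivAt_sin x)
      hs.ne').const_sub 1).congr_deriv ?_
    simp only [Pi.mul_apply]
    field_simp
    linear_combination x * Real.sin_sq_add_cos_sq x
  · refine (((hasDerivAt_id' x).div ((Real.hasDerivAt_sin x).pow 2) (pow_ne_zero 2 hs.ne')).sub
      ((Real.hasDerivAt_cos x).div (Real.hasDerivAt_sin x) hs.ne')).congr_deriv ?_
    simp only [Pi.pow_apply]
    push_cast
    field_simp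
    linear_combination Real.sin x * Real.sin_sq_add_cos_sq x
  · have := sub_nonneg.2 (self_mul_cos_le_sin hx0.le hx.2.le)
    positivity

lemma nonnegMonoConvexOn_C1 (lam : ℝ) : NonnegMonoConvexOn (C1 lam) (Ici 0) := by
  rcases le_or_gt 0 lam with h | h
  · exact (NonnegMonoConvexOn.const (convex_Ici 0) zero_le_one).congr fun x _ => by simp [C1, h]
  · have hs : 0 < √(-lam) := Real.sqrt_pos.2 (neg_pos.2 h)
    refine (nonnegMonoConvexOn_sinhc.comp_affine (c := √(-lam)) (d := 0) (convex_Ici 0) hs.le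
      fun x hx => ?_).congr fun x _ => ?_
    · simpa using mul_nonneg hs.le hx
    · rcases eq_or_ne x 0 with rfl | hx
      · simp [C1, sinhc_zero]
      · simp [C1, h.not_ge, hx, sinhc_of_ne_zero (mul_ne_zero hs.ne' hx)]

lemma nonnegMonoConvexOn_psiFun {lam R : ℝ} (hR : R * √(max 0 lam) < π) :
    NonnegMonoConvexOn (psiFun lam) (Icc 0 R) := by
  rcases lt_trichotomy lam 0 with h | rfl | h
  · have hs : 0 < √(-lam) := Real.sqrt_pos.2 (neg_pos.2 h)
    refine (nonnegMonoConvexOn_cosh_div_sinhc.comp_affine (c := √(-lam)) (d := 0) (convex_Icc 0 R)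
      hs.le fun x hx => ?_).congr fun x _ => ?_
    · simpa using mul_nonneg hs.le hx.1
    · rcases eq_or_ne x 0 with rfl | hx
      · simp [psiFun, hFun, sinhc_zero]
      · simp only [add_zero, sinhc_of_ne_zero (mul_ne_zero hs.ne' hx)]
        simp only [psiFun, hFun, hx, h.ne, h.not_gt, or_self, if_false, Real.sign_of_neg h,
          div_div_eq_mul_div]
        ring
  · exact (NonnegMonoConvexOn.const (convex_Icc 0 R) le_rfl).congr fun x _ => by simp [psiFun]
  · have hs : 0 < √lam := Real.sqrt_pos.2 h
    rw [max_eq_right h.le] at hR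
    refine (nonnegMonoConvexOn_cos_div_sinc.comp_affine (c := √lam) (d := 0) (convex_Icc 0 R)
      hs.le fun x hx => ⟨?_, ?_⟩).congr fun x _ => ?_
    · simpa using mul_nonneg hs.le hx.1
    · simp only [add_zero, mul_comm (√lam)]
      exact (mul_le_mul_of_nonneg_right hx.2 hs.le).trans_lt hR
    · rcases eq_or_ne x 0 with rfl | hx
      · simp [psiFun, hFun]
      · simp only [add_zero, Real.sinc_of_ne_zero (mul_ne_zero hs.ne' hx)]
        simp only [psiFun, hFun, hx, h.ne', h, or_self, if_false, if_true, Real.sign_of_pos h,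
          div_div_eq_mul_div]
        ring

/-- Conclusion 5 of Lemma 4.5 of the paper (constant curvature bounds): for each
`D ∈ [0,r₁]`, the function `ρ ↦ κ̃(ρ,D)` is continuous, monotone nondecreasing, and
convex on `[D,r₁]`. -/
theorem stmt17 (δ Δ r₁ : ℝ) (hδΔ : δ ≤ Δ) (hr₁ : 0 < r₁)
    (hreg : 2 * r₁ * Real.sqrt (max 0 Δ) < π)
    (D : ℝ) (hD : D ∈ Set.Icc 0 r₁) :
    ContinuousOn (fun ρ => kappaT δ Δ ρ D) (Set.Icc D r₁) ∧
    MonotoneOn (fun ρ => kappaT δ Δ ρ D) (Set.Icc D r₁) ∧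
    ConvexOn ℝ (Set.Icc D r₁) (fun ρ => kappaT δ Δ ρ D) := by
  have hreg' : 2 * r₁ * √(max 0 δ) < π := lt_of_le_of_lt (by gcongr) hreg
  have hφ : NonnegMonoConvexOn (fun ρ => phiMinus ((ρ + D) * √(max |δ| |Δ|))) (Icc D r₁) := by
    refine (nonnegMonoConvexOn_phiMinus.comp_affine (c := √(max |δ| |Δ|))
      (d := √(max |δ| |Δ|) * D) (convex_Icc D r₁) (Real.sqrt_nonneg _) fun x hx => ?_).congr
      fun x _ => by ring_nf
    exact add_nonneg (mul_nonneg (Real.sqrt_nonneg _) (hD.1.trans hx.1))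
      (mul_nonneg (Real.sqrt_nonneg _) hD.1)
  have hC : NonnegMonoConvexOn (fun ρ => C1 δ (ρ + D)) (Icc D r₁) :=
    ((nonnegMonoConvexOn_C1 δ).comp_affine (c := 1) (d := D) (convex_Icc D r₁) zero_le_one
      fun x hx => by simpa using add_nonneg (hD.1.trans hx.1) hD.1).congr fun x _ => by
        simp only [one_mul]
  have hψ : NonnegMonoConvexOn (fun ρ => psiMax δ Δ (ρ + D)) (Icc D r₁) :=
    (((nonnegMonoConvexOn_psiFun hreg).max (nonnegMonoConvexOn_psiFun hreg')).comp_affine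
      (c := 1) (d := D) (convex_Icc D r₁) zero_le_one
      fun x hx => ⟨by linarith [hx.1, hD.1], by linarith [hx.2, hD.2]⟩).congr fun x _ => by
        simp only [one_mul, psiMax]
  have h := hφ.add (hC.mul hψ)
  exact ⟨h.cont, h.mono, h.convex⟩
end
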